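/- For any two partitions μ, ν of length at most m, the product s_μ(y₁,…,yₘ) · s_ν(y₁,…,yₘ) of Schur polynomials is a nonnegative integer linear combination of Schur polynomials s_λ with λ of length at most m. -/

import Mathlib

open MvPolynomial

/-- The complete homogeneous symmetric polynomial of degree `k` in `m` variables. -/
noncomputable def completeHomog (m k : ℕ) : MvPolynomial (Fin m) ℤ :=
  ∑ d ∈ Finset.Nat.antidiagonalTuple m k, ∏ i, MvPolynomial.X i ^ d i

/-- The Schur polynomial of `μ` in `m` variables, via the Jacobi–Trudi determinant
`s_μ = det (h_{μ_i - i + j})` (indices `0,…,m-1`; entries with negative subscript are 0). -/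
noncomputable def schurPoly (m : ℕ) (μ : Fin m → ℕ) : MvPolynomial (Fin m) ℤ :=
  Matrix.det (Matrix.of fun i j : Fin m =>
    if (i : ℕ) ≤ μ i + j then completeHomog m (μ i + j - i) else 0)

/-- The alternant `det (x_l ^ β_i)`. -/
noncomputable def alternant (m : ℕ) (β : Fin m → ℕ) : MvPolynomial (Fin m) ℤ :=
  Matrix.det (Matrix.of fun l i : Fin m => (X l : MvPolynomial (Fin m) ℤ) ^ β i)

/-- The staircase exponent `(m-1, …, 1, 0)`. -/
def staircase (m : ℕ) (i : Fin m) : ℕ := m - 1 - i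

theorem PowerSeries.mk_pow_mul_one_sub {R : Type*} [CommRing R] (a : R) :
    (PowerSeries.mk fun n => a ^ n) * (1 - PowerSeries.C a * PowerSeries.X) = 1 := by
  ext n
  rw [mul_sub, mul_one, mul_comm (PowerSeries.C a), ← mul_assoc]
  cases n with
  | zero => simp
  | succ n => simp [PowerSeries.coeff_succ_mul_X, PowerSeries.coeff_one, pow_succ]

theorem prod_mk_pow_eq_mk_completeHomog (m : ℕ) :
    ∏ i : Fin m, (PowerSeries.mk fun n => (X i : MvPolynomial (Fin m) ℤ) ^ n) =
      PowerSeries.mk (completeHomog m) := by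
  ext1 n
  rw [PowerSeries.coeff_prod, PowerSeries.coeff_mk, completeHomog]
  refine Finset.sum_nbij' (fun l => ⇑l) (fun d => Finsupp.equivFunOnFinite.symm d) ?_ ?_ ?_ ?_ ?_
  · intro l hl
    simpa [Finset.Nat.mem_antidiagonalTuple] using hl
  · intro d hd
    simpa [Finset.Nat.mem_antidiagonalTuple] using hd
  · intro l _
    ext; simp
  · intro d _
    ext; simp
  · intro l _
    simp

/-- The polynomial `∏_{i ≠ l} (1 - x_i t)`. -/
noncomputable def complementPoly (m : ℕ) (l : Fin m) : Polynomial (MvPolynomial (Fin m) ℤ) :=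
  ∏ i ∈ Finset.univ.erase l, (1 - Polynomial.C (X i) * Polynomial.X)

theorem natDegree_complementPoly_lt (m : ℕ) (l : Fin m) : (complementPoly m l).natDegree < m := by
  have h : (complementPoly m l).natDegree ≤ (Finset.univ.erase l).card * 1 := by
    refine (Polynomial.natDegree_prod_le _ _).trans (Finset.sum_le_card_nsmul _ _ _ ?_)
    intro i _
    compute_degree
  rw [Finset.card_erase_of_mem (Finset.mem_univ l), Finset.card_fin] at h
  have := l.pos
  omega

theorem mk_completeHomog_mul_complementPoly (m : ℕ) (l : Fin m) :
    PowerSeries.mk (completeHomog m) * (complementPoly m l : PowerSeries (MvPolynomial (Fin m) ℤ)) =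
      PowerSeries.mk fun n => (X l : MvPolynomial (Fin m) ℤ) ^ n := by
  have h : (complementPoly m l : PowerSeries (MvPolynomial (Fin m) ℤ)) =
      ∏ i ∈ Finset.univ.erase l, (1 - PowerSeries.C (X i) * PowerSeries.X) := by
    rw [complementPoly, ← Polynomial.coeToPowerSeries.ringHom_apply, map_prod]
    simp
  rw [h, ← prod_mk_pow_eq_mk_completeHomog, ← Finset.mul_prod_erase _ _ (Finset.mem_univ l),
    mul_assoc, ← Finset.prod_mul_distrib,
    Finset.prod_congr rfl fun i _ => PowerSeries.mk_pow_mul_one_sub _]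
  simp

/-- `completeHomog` extended by zero to negative degrees. -/
noncomputable def completeHomogInt (m : ℕ) (k : ℤ) : MvPolynomial (Fin m) ℤ :=
  if 0 ≤ k then completeHomog m k.toNat else 0

theorem X_pow_eq_sum_completeHomogInt (m : ℕ) (l : Fin m) (n : ℕ) :
    (X l : MvPolynomial (Fin m) ℤ) ^ n =
      ∑ j : Fin m, completeHomogInt m ((n : ℤ) - (m - 1 - j : ℕ)) *
        (complementPoly m l).coeff (m - 1 - j) := by
  have h := congrArg (PowerSeries.coeff n) (mk_completeHomog_mul_complementPoly m l)
  rw [mul_comm, PowerSeries.coeff_mul, Finset.Nat.sum_antidiagonal_eq_sum_range_succ_mk,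
    PowerSeries.coeff_mk] at h
  let f : ℕ → MvPolynomial (Fin m) ℤ := fun p =>
    completeHomogInt m ((n : ℤ) - p) * (complementPoly m l).coeff p
  have h₁ : ∑ p ∈ Finset.range (n + 1), f p = (X l : MvPolynomial (Fin m) ℤ) ^ n := by
    rw [← h]
    refine Finset.sum_congr rfl fun p hp => ?_
    have hp' : p ≤ n := Nat.lt_succ_iff.mp (Finset.mem_range.mp hp)
    rw [mul_comm, Polynomial.coeff_coe, PowerSeries.coeff_mk]
    simp only [f, completeHomogInt]
    rw [if_pos (by omega)]
    congr 2
    omega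
  have h₂ : ∑ p ∈ Finset.range m, f p = ∑ p ∈ Finset.range (n + 1), f p := by
    rw [Finset.sum_subset (Finset.range_mono (le_max_left m (n + 1))),
      Finset.sum_subset (Finset.range_mono (le_max_right m (n + 1)))]
    · intro p _ hp
      rw [Finset.mem_range] at hp
      simp only [f, completeHomogInt]
      rw [if_neg (by omega), zero_mul]
    · intro p _ hp
      rw [Finset.mem_range, not_lt] at hp
      simp only [f]
      rw [Polynomial.coeff_eq_zero_of_natDegree_lt
        ((natDegree_complementPoly_lt m l).trans_le hp), mul_zero]
  rw [← h₁, ← h₂, ← Finset.sum_range_reflect, Finset.sum_range]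

theorem schurPoly_eq_det_completeHomogInt (m : ℕ) (μ : Fin m → ℕ) :
    schurPoly m μ =
      Matrix.det (Matrix.of fun i j : Fin m => completeHomogInt m ((μ i : ℤ) + j - i)) := by
  unfold schurPoly completeHomogInt
  congr 2
  ext1 i
  ext1 j
  by_cases h : (i : ℕ) ≤ μ i + j
  · rw [if_pos h, if_pos (by omega)]
    congr 1
    omega
  · rw [if_neg h, if_neg (by omega)]

/-- The matrix of coefficients of the polynomials `∏_{i ≠ l} (1 - x_i t)`. -/
noncomputable def complementMatrix (m : ℕ) : Matrix (Fin m) (Fin m) (MvPolynomial (Fin m) ℤ) :=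
  Matrix.of fun j l => (complementPoly m l).coeff (m - 1 - j)

theorem schurPoly_mul_det_complementMatrix (m : ℕ) (μ : Fin m → ℕ) :
    schurPoly m μ * (complementMatrix m).det = alternant m (μ + staircase m) := by
  rw [schurPoly_eq_det_completeHomogInt, ← Matrix.det_mul, alternant, ← Matrix.det_transpose]
  congr 1
  refine Matrix.ext fun l i => ?_
  rw [Matrix.transpose_apply, Matrix.mul_apply, Matrix.of_apply, X_pow_eq_sum_completeHomogInt]
  refine Finset.sum_congr rfl fun j _ => ?_
  simp only [Matrix.of_apply, complementMatrix, Pi.add_apply, staircase]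
  congr 2
  omega

theorem alternant_staircase_ne_zero (m : ℕ) : alternant m (staircase m) ≠ 0 := by
  have h : (Matrix.of fun l i : Fin m => (X l : MvPolynomial (Fin m) ℤ) ^ staircase m i) =
      (Matrix.vandermonde fun l : Fin m => (X l : MvPolynomial (Fin m) ℤ)).submatrix id
        Fin.revPerm := by
    refine Matrix.ext fun l i => ?_
    simp only [Matrix.of_apply, staircase, Matrix.submatrix_apply, Matrix.vandermonde_apply, id,
      Fin.revPerm_apply, Fin.val_rev]
    congr 1
    omega
  rw [alternant, h, Matrix.det_permute']
  refine mul_ne_zero ?_ (Matrix.det_vandermonde_ne_zero_iff.mpr MvPolynomial.X_injective)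
  rcases Int.units_eq_one_or (Equiv.Perm.sign (Fin.revPerm : Equiv.Perm (Fin m))) with h | h <;>
    simp [h]

theorem det_complementMatrix_ne_zero (m : ℕ) : (complementMatrix m).det ≠ 0 := by
  intro h
  have := schurPoly_mul_det_complementMatrix m 0
  rw [h, mul_zero, zero_add] at this
  exact alternant_staircase_ne_zero m this.symm

theorem alternant_mul_completeHomog (m : ℕ) (β : Fin m → ℕ) (k : ℕ) :
    alternant m β * completeHomog m k =
      ∑ d ∈ Finset.Nat.antidiagonalTuple m k, alternant m (β + d) := by
  simp only [alternant, Matrix.det_apply', Matrix.of_apply]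
  rw [Finset.sum_comm, Finset.sum_mul]
  refine Finset.sum_congr rfl fun σ _ => ?_
  have h : completeHomog m k =
      ∑ d ∈ Finset.Nat.antidiagonalTuple m k, ∏ i, (X (σ i) : MvPolynomial (Fin m) ℤ) ^ d i := by
    unfold completeHomog
    refine Finset.sum_nbij' (fun d => d ∘ σ) (fun d => d ∘ σ.symm) ?_ ?_ ?_ ?_ ?_
    · intro d hd
      rw [Finset.Nat.mem_antidiagonalTuple] at hd ⊢
      exact (Equiv.sum_comp σ d).trans hd
    · intro d hd
      rw [Finset.Nat.mem_antidiagonalTuple] at hd ⊢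
      exact (Equiv.sum_comp σ.symm d).trans hd
    · intro d _
      ext; simp
    · intro d _
      ext; simp
    · intro d _
      exact (Equiv.prod_comp σ fun i => (X i : MvPolynomial (Fin m) ℤ) ^ d i).symm
  rw [h, Finset.mul_sum]
  refine Finset.sum_congr rfl fun d _ => ?_
  simp only [Pi.add_apply, pow_add, Finset.prod_mul_distrib, mul_assoc]

theorem alternant_comp_swap (m : ℕ) (β : Fin m → ℕ) {i j : Fin m} (hij : i ≠ j) :
    alternant m (β ∘ Equiv.swap i j) = -alternant m β := by
  have := Matrix.det_permute' (Equiv.swap i j)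
    (Matrix.of fun l i : Fin m => (X l : MvPolynomial (Fin m) ℤ) ^ β i)
  rw [Equiv.Perm.sign_swap hij] at this
  simpa [alternant, Matrix.submatrix] using this

/-- A sum with a sign-reversing involution vanishes; the involution is `a ↦ t i a`, where `i` is
the unique label with `P a i`. -/
theorem Finset.sum_eq_zero_of_sign_reversing {α ι M : Type*} [AddCommGroup M] [IsAddTorsionFree M]
    (s : Finset α) (f : α → M) (P : α → ι → Prop) (t : ι → α → α)
    (hex : ∀ a ∈ s, ∃ i, P a i) (huniq : ∀ a i j, P a i → P a j → i = j)
    (hmem : ∀ a ∈ s, ∀ i, P a i → t i a ∈ s) (hP : ∀ a ∈ s, ∀ i, P a i → P (t i a) i)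
    (hinv : ∀ a ∈ s, ∀ i, P a i → t i (t i a) = a)
    (hneg : ∀ a ∈ s, ∀ i, P a i → f (t i a) = -f a) :
    ∑ a ∈ s, f a = 0 := by
  choose i hi using hex
  refine Finset.sum_involution (fun a ha => t (i a ha) a) ?_ ?_ ?_ ?_
  · intro a ha
    rw [hneg a ha _ (hi a ha), add_neg_cancel]
  · intro a ha h0 h
    have := hneg a ha _ (hi a ha)
    rw [h] at this
    exact h0 (self_eq_neg.mp this)
  · exact fun a ha => hmem a ha _ (hi a ha)
  · intro a ha
    have := huniq _ _ _ (hi _ (hmem a ha _ (hi a ha))) (hP a ha _ (hi a ha))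
    simp only [this, hinv a ha _ (hi a ha)]

/-- `lam / ν` is a horizontal strip: `ν_j ≤ lam_j` and `lam_{j+1} ≤ ν_j`. -/
def IsHorizontalStrip {m : ℕ} (ν lam : Fin m → ℕ) : Prop :=
  (∀ j, ν j ≤ lam j) ∧ ∀ j j' : Fin m, (j : ℕ) + 1 = j' → lam j' ≤ ν j

theorem IsHorizontalStrip.antitone {m : ℕ} {ν lam : Fin m → ℕ} (h : IsHorizontalStrip ν lam) :
    Antitone lam := by
  cases m with
  | zero => exact Subsingleton.antitone lam
  | succ n =>
    exact Fin.antitone_iff_succ_le.mpr fun i =>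
      (h.2 i.castSucc i.succ (by simp)).trans (h.1 _)

/-- `(j, j+1)` is the last pair of rows where `ν + d` violates the horizontal strip condition. -/
def IsLastViolation {m : ℕ} (ν d : Fin m → ℕ) (p : Fin m × Fin m) : Prop :=
  (p.1 : ℕ) + 1 = p.2 ∧ ν p.1 < ν p.2 + d p.2 ∧
    ∀ i i' : Fin m, (i : ℕ) + 1 = i' → p.1 < i → ν i' + d i' ≤ ν i

theorem IsLastViolation.unique {m : ℕ} {ν d : Fin m → ℕ} {p q : Fin m × Fin m}
    (hp : IsLastViolation ν d p) (hq : IsLastViolation ν d q) : p = q := by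
  obtain ⟨h₁, h₂, h₃⟩ := hp
  obtain ⟨h₄, h₅, h₆⟩ := hq
  have h : p.1 = q.1 := by
    rcases lt_trichotomy p.1 q.1 with h | h | h
    · exact absurd (h₃ _ _ h₄ h) h₅.not_ge
    · exact h
    · exact absurd (h₆ _ _ h₁ h) h₂.not_ge
  refine Prod.ext h (Fin.ext ?_)
  rw [← h₁, ← h₄, h]

theorem exists_isLastViolation {m : ℕ} {ν d : Fin m → ℕ} (h : ¬IsHorizontalStrip ν (ν + d)) :
    ∃ p, IsLastViolation ν d p := by
  classical
  have h' : ∃ p : Fin m × Fin m, (p.1 : ℕ) + 1 = p.2 ∧ ν p.1 < ν p.2 + d p.2 := by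
    by_contra! hcon
    exact h ⟨fun j => Nat.le_add_right _ _, fun j j' hj => hcon (j, j') hj⟩
  obtain ⟨p₀, hp₀⟩ := h'
  obtain ⟨p, hp, hmax⟩ := Finset.exists_max_image
    (Finset.univ.filter fun p : Fin m × Fin m => (p.1 : ℕ) + 1 = p.2 ∧ ν p.1 < ν p.2 + d p.2)
    (fun p => p.1) ⟨p₀, by simpa using hp₀⟩
  simp only [Finset.mem_filter, Finset.mem_univ, true_and] at hp hmax
  refine ⟨p, hp.1, hp.2, fun i i' hi hpi => ?_⟩
  by_contra! hcon
  exact absurd (hmax (i, i') ⟨hi, hcon⟩) hpi.not_ge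

/-- The exponent `d'` for which `ν + staircase + d'` is `ν + staircase + d` with the entries
`p.1`, `p.2` exchanged. -/
def swapExponent {m : ℕ} (ν : Fin m → ℕ) (p : Fin m × Fin m) (d : Fin m → ℕ) : Fin m → ℕ :=
  fun x => (ν + staircase m + d) (Equiv.swap p.1 p.2 x) - (ν + staircase m) x

theorem add_swapExponent {m : ℕ} {ν d : Fin m → ℕ} {p : Fin m × Fin m} (hν : Antitone ν)
    (hp : IsLastViolation ν d p) :
    ν + staircase m + swapExponent ν p d = (ν + staircase m + d) ∘ Equiv.swap p.1 p.2 := by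
  obtain ⟨h₁, h₂, -⟩ := hp
  have h₃ : ν p.2 ≤ ν p.1 := hν (by rw [Fin.le_def]; omega)
  ext x
  simp only [swapExponent, Pi.add_apply, Function.comp_apply]
  apply Nat.add_sub_cancel'
  rcases eq_or_ne x p.1 with rfl | hx
  · rw [Equiv.swap_apply_left]
    simp only [staircase]
    omega
  rcases eq_or_ne x p.2 with rfl | hx'
  · rw [Equiv.swap_apply_right]
    simp only [staircase]
    omega
  · rw [Equiv.swap_apply_of_ne_of_ne hx hx']
    omega

theorem IsLastViolation.swapExponent {m : ℕ} {ν d : Fin m → ℕ} {p : Fin m × Fin m}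
    (hν : Antitone ν) (hp : IsLastViolation ν d p) :
    IsLastViolation ν (swapExponent ν p d) p := by
  have h := add_swapExponent hν hp
  obtain ⟨h₁, h₂, h₃⟩ := hp
  refine ⟨h₁, ?_, fun i i' hi hpi => ?_⟩
  · have := congrFun h p.2
    simp only [Pi.add_apply, Function.comp_apply, Equiv.swap_apply_right, staircase] at this
    omega
  · have := congrFun h i'
    simp only [Pi.add_apply, Function.comp_apply] at this
    rw [Equiv.swap_apply_of_ne_of_ne (by rw [Fin.ne_iff_vne]; rw [Fin.lt_def] at hpi; omega)
      (by rw [Fin.ne_iff_vne]; rw [Fin.lt_def] at hpi; omega)] at this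
    have := h₃ i i' hi hpi
    omega

theorem swapExponent_swapExponent {m : ℕ} {ν d : Fin m → ℕ} {p : Fin m × Fin m}
    (hν : Antitone ν) (hp : IsLastViolation ν d p) :
    swapExponent ν p (swapExponent ν p d) = d := by
  have h := add_swapExponent hν (hp.swapExponent hν)
  rw [add_swapExponent hν hp] at h
  ext x
  have := congrFun h x
  simp only [Pi.add_apply, Function.comp_apply, Equiv.swap_apply_self] at this
  omega

theorem sum_swapExponent {m : ℕ} {ν d : Fin m → ℕ} {p : Fin m × Fin m}
    (hν : Antitone ν) (hp : IsLastViolation ν d p) :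
    ∑ i, swapExponent ν p d i = ∑ i, d i := by
  have h : ∑ i, (ν + staircase m + swapExponent ν p d) i = ∑ i, (ν + staircase m + d) i := by
    rw [add_swapExponent hν hp]
    exact Equiv.sum_comp _ _
  simpa [Finset.sum_add_distrib] using h

open Classical in
theorem sum_alternant_not_isHorizontalStrip {m : ℕ} {ν : Fin m → ℕ} (hν : Antitone ν) (k : ℕ) :
    ∑ d ∈ Finset.Nat.antidiagonalTuple m k with ¬IsHorizontalStrip ν (ν + d),
      alternant m (ν + staircase m + d) = 0 := by
  refine Finset.sum_eq_zero_of_sign_reversing _ _ (IsLastViolation ν) (swapExponent ν) ?_ ?_ ?_ ?_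
    ?_ ?_
  · intro d hd
    exact exists_isLastViolation (Finset.mem_filter.mp hd).2
  · exact fun d p q hp hq => hp.unique hq
  · intro d hd p hp
    rw [Finset.mem_filter, Finset.Nat.mem_antidiagonalTuple] at hd ⊢
    refine ⟨(sum_swapExponent hν hp).trans hd.1, fun hs => ?_⟩
    have h := hp.swapExponent hν
    exact absurd (hs.2 p.1 p.2 h.1) h.2.1.not_ge
  · exact fun d _ p hp => hp.swapExponent hν
  · exact fun d _ p hp => swapExponent_swapExponent hν hp
  · intro d _ p hp
    rw [add_swapExponent hν hp]
    refine alternant_comp_swap m _ fun h => ?_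
    have := hp.1
    rw [h] at this
    omega

open Classical in
/-- The Pieri rule. -/
theorem schurPoly_mul_completeHomog {m : ℕ} {ν : Fin m → ℕ} (hν : Antitone ν) (k : ℕ) :
    schurPoly m ν * completeHomog m k =
      ∑ d ∈ Finset.Nat.antidiagonalTuple m k with IsHorizontalStrip ν (ν + d),
        schurPoly m (ν + d) := by
  refine mul_right_cancel₀ (det_complementMatrix_ne_zero m) ?_
  rw [Finset.sum_mul, mul_right_comm, schurPoly_mul_det_complementMatrix,
    alternant_mul_completeHomog,
    ← Finset.sum_filter_add_sum_filter_not _ fun d => IsHorizontalStrip ν (ν + d),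
    sum_alternant_not_isHorizontalStrip hν, add_zero]
  refine Finset.sum_congr rfl fun d _ => ?_
  rw [schurPoly_mul_det_complementMatrix, add_right_comm]

open Classical in
/-- The Pieri rule, with the sum ranging over shapes in a box. -/
theorem schurPoly_mul_completeHomogInt {m : ℕ} {ν : Fin m → ℕ} (hν : Antitone ν) (k : ℤ) (N : ℕ)
    (hN : ∑ j, ν j + k.toNat ≤ N) :
    schurPoly m ν * completeHomogInt m k =
      ∑ lam : Fin m → Fin (N + 1) with IsHorizontalStrip ν (fun j => (lam j : ℕ)) ∧
        ∑ j, (lam j : ℤ) - ∑ j, (ν j : ℤ) = k, schurPoly m (fun j => (lam j : ℕ)) := by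
  unfold completeHomogInt
  split_ifs with hk
  · rw [schurPoly_mul_completeHomog hν]
    have hle : ∀ d ∈ Finset.Nat.antidiagonalTuple m k.toNat, ∀ j, ν j + d j < N + 1 := by
      intro d hd j
      rw [Finset.Nat.mem_antidiagonalTuple] at hd
      have h₁ := Finset.single_le_sum (f := ν) (fun i _ => Nat.zero_le _) (Finset.mem_univ j)
      have h₂ := Finset.single_le_sum (f := d) (fun i _ => Nat.zero_le _) (Finset.mem_univ j)
      omega
    have hval : ∀ d ∈ Finset.Nat.antidiagonalTuple m k.toNat,
        (fun j => (Fin.ofNat (N + 1) (ν j + d j) : ℕ)) = ν + d := by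
      intro d hd
      ext j
      exact Nat.mod_eq_of_lt (hle d hd j)
    refine Finset.sum_bij' (fun d _ j => Fin.ofNat (N + 1) (ν j + d j))
      (fun lam _ j => (lam j : ℕ) - ν j) ?_ ?_ ?_ ?_ ?_
    · intro d hd
      rw [Finset.mem_filter] at hd ⊢
      refine ⟨Finset.mem_univ _, ?_, ?_⟩
      · rw [hval d hd.1]
        exact hd.2
      · have h := Finset.Nat.mem_antidiagonalTuple.mp hd.1
        have h' : ∑ j, (Fin.ofNat (N + 1) (ν j + d j) : ℕ) = ∑ j, ν j + ∑ j, d j := by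
          rw [← Finset.sum_add_distrib]
          exact Finset.sum_congr rfl fun j _ => congrFun (hval d hd.1) j
        zify at h h'
        rw [h']
        omega
    · intro lam hlam
      rw [Finset.mem_filter] at hlam ⊢
      obtain ⟨-, hs, hk'⟩ := hlam
      have hadd : ν + (fun j => (lam j : ℕ) - ν j) = fun j => (lam j : ℕ) :=
        funext fun j => Nat.add_sub_cancel' (hs.1 j)
      refine ⟨?_, by rwa [hadd]⟩
      rw [Finset.Nat.mem_antidiagonalTuple]
      have h := congrArg (fun f : Fin m → ℕ => ∑ j, f j) hadd
      simp only [Pi.add_apply, Finset.sum_add_distrib] at h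
      zify at h
      zify
      omega
    · intro d hd
      ext j
      have := congrFun (hval d (Finset.mem_filter.mp hd).1) j
      simp only [Pi.add_apply] at this
      simp only [this, Nat.add_sub_cancel_left]
    · intro lam hlam
      ext j
      have h := (Finset.mem_filter.mp hlam).2.1.1 j
      have := (lam j).isLt
      simp only [Fin.val_ofNat]
      rw [Nat.add_sub_cancel' h, Nat.mod_eq_of_lt this]
    · intro d hd
      rw [hval d (Finset.mem_filter.mp hd).1]
  · rw [mul_zero]
    symm
    refine Finset.sum_eq_zero fun lam hlam => ?_
    obtain ⟨-, h, hs⟩ := Finset.mem_filter.mp hlam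
    exfalso
    have : ∑ j, (ν j : ℤ) ≤ ∑ j, (lam j : ℤ) :=
      Finset.sum_le_sum fun j _ => by exact_mod_cast h.1 j
    omega

/-- Consecutive shapes of `Q` differ by horizontal strips. -/
def IsStripChain {m n : ℕ} (Q : Fin (n + 1) → Fin m → ℕ) : Prop :=
  ∀ i : Fin n, IsHorizontalStrip (Q i.castSucc) (Q i.succ)

/-- The sizes of the successive strips of `Q`. -/
def chainContent {m n : ℕ} (Q : Fin (n + 1) → Fin m → ℕ) (i : Fin n) : ℤ :=
  ∑ j, (Q i.succ j : ℤ) - ∑ j, (Q i.castSucc j : ℤ)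

/-- The chain of shapes underlying a chain in a box. -/
def boxChain {m n N : ℕ} (Q : Fin (n + 1) → Fin m → Fin (N + 1)) : Fin (n + 1) → Fin m → ℕ :=
  fun i j => Q i j

theorem isStripChain_boxChain_cons {m n N : ℕ} (ν : Fin m → Fin (N + 1))
    (Q : Fin (n + 1) → Fin m → Fin (N + 1)) :
    IsStripChain (boxChain (Fin.cons ν Q : Fin (n + 2) → Fin m → Fin (N + 1))) ↔
      IsHorizontalStrip (fun j => (ν j : ℕ)) (fun j => (Q 0 j : ℕ)) ∧
        IsStripChain (boxChain Q) := by
  unfold IsStripChain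
  rw [Fin.forall_fin_succ]
  exact Iff.rfl

theorem chainContent_boxChain_cons {m n N : ℕ} (ν : Fin m → Fin (N + 1))
    (Q : Fin (n + 1) → Fin m → Fin (N + 1)) (α : Fin (n + 1) → ℤ) :
    chainContent (boxChain (Fin.cons ν Q : Fin (n + 2) → Fin m → Fin (N + 1))) = α ↔
      ∑ j, (Q 0 j : ℤ) - ∑ j, (ν j : ℤ) = α 0 ∧
        chainContent (boxChain Q) = fun i => α i.succ := by
  rw [funext_iff, Fin.forall_fin_succ, funext_iff]
  exact Iff.rfl

open Classical in
theorem schurPoly_mul_prod_completeHomogInt {m n N : ℕ} (ν : Fin m → Fin (N + 1))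
    (hν : Antitone fun j => (ν j : ℕ)) (α : Fin n → ℤ)
    (hN : ∑ j, (ν j : ℕ) + ∑ i, (α i).toNat ≤ N) :
    schurPoly m (fun j => ν j) * ∏ i, completeHomogInt m (α i) =
      ∑ Q : Fin (n + 1) → Fin m → Fin (N + 1) with
        Q 0 = ν ∧ IsStripChain (boxChain Q) ∧ chainContent (boxChain Q) = α,
          schurPoly m (boxChain Q (Fin.last n)) := by
  induction n generalizing ν with
  | zero =>
    rw [Finset.sum_eq_single fun _ => ν]
    · rw [Finset.univ_eq_empty, Finset.prod_empty, mul_one]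
      rfl
    · intro Q hQ hne
      refine absurd (_root_.funext fun i => ?_) hne
      rw [Fin.fin_one_eq_zero i]
      exact (Finset.mem_filter.mp hQ).2.1
    · intro h
      exact absurd (Finset.mem_filter.mpr
        ⟨Finset.mem_univ _, rfl, fun i => i.elim0, Subsingleton.elim _ _⟩) h
  | succ n ih =>
    rw [Fin.sum_univ_succ] at hN
    rw [Fin.prod_univ_succ, ← mul_assoc, schurPoly_mul_completeHomogInt hν (α 0) N (by omega),
      Finset.sum_mul]
    have hstep : ∀ lam ∈ Finset.univ.filter (fun lam : Fin m → Fin (N + 1) =>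
        IsHorizontalStrip (fun j => (ν j : ℕ)) (fun j => (lam j : ℕ)) ∧
          ∑ j, (lam j : ℤ) - ∑ j, (ν j : ℤ) = α 0),
        schurPoly m (fun j => (lam j : ℕ)) * ∏ i : Fin n, completeHomogInt m (α i.succ) =
          ∑ Q : Fin (n + 1) → Fin m → Fin (N + 1) with
            Q 0 = lam ∧ IsStripChain (boxChain Q) ∧
              chainContent (boxChain Q) = fun i => α i.succ,
            schurPoly m (boxChain Q (Fin.last n)) := by
      intro lam hlam
      obtain ⟨-, h, hs⟩ := Finset.mem_filter.mp hlam
      refine ih lam h.antitone _ ?_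
      zify at hN ⊢
      have : ∑ j, (ν j : ℤ) ≤ ∑ j, (lam j : ℤ) :=
        Finset.sum_le_sum fun j _ => by exact_mod_cast h.1 j
      omega
    rw [Finset.sum_congr rfl hstep, Finset.sum_sigma']
    refine Finset.sum_bij' (fun x _ => Fin.cons ν x.2) (fun Q _ => ⟨Q 1, Fin.tail Q⟩) ?_ ?_ ?_ ?_ ?_
    · rintro ⟨lam, Q⟩ h
      simp only [Finset.mem_sigma, Finset.mem_filter, Finset.mem_univ, true_and] at h ⊢
      rw [isStripChain_boxChain_cons, chainContent_boxChain_cons]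
      obtain ⟨⟨h₁, h₂⟩, rfl, h₃, h₄⟩ := h
      exact ⟨rfl, ⟨h₁, h₃⟩, h₂, h₄⟩
    · intro Q h
      simp only [Finset.mem_sigma, Finset.mem_filter, Finset.mem_univ, true_and] at h ⊢
      rw [← Fin.cons_self_tail Q, isStripChain_boxChain_cons, chainContent_boxChain_cons] at h
      obtain ⟨rfl, ⟨h₁, h₂⟩, h₃, h₄⟩ := h
      exact ⟨⟨h₁, h₃⟩, rfl, h₂, h₄⟩
    · rintro ⟨lam, Q⟩ h
      simp only [Finset.mem_sigma, Finset.mem_filter, Finset.mem_univ, true_and] at h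
      obtain ⟨-, rfl, -⟩ := h
      rfl
    · intro Q h
      rw [← (Finset.mem_filter.mp h).2.1]
      exact Fin.cons_self_tail Q
    · intro x _
      rfl

/-- A chain of horizontal strips of length `m` between shapes with `m` rows, indexed by natural
numbers and extended by zero. -/
structure IsExtendedChain (m : ℕ) (q : ℕ → ℕ → ℤ) : Prop where
  nonneg : ∀ i j, 0 ≤ q i j
  level_zero : ∀ i j, m < i → q i j = 0
  row_zero : ∀ i j, m ≤ j → q i j = 0
  mono : ∀ i j, i < m → q i j ≤ q (i + 1) j
  interlace : ∀ i j, i < m → q (i + 1) (j + 1) ≤ q i j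

/-- The excess, in the rows above `r`, of the size of the strip from level `k` to `k + 1` over the
size of the next strip. -/
def stripExcess (q : ℕ → ℕ → ℤ) (r k : ℕ) : ℤ :=
  ∑ s ∈ Finset.range r, (2 * q (k + 1) s - q k s - q (k + 2) s)

/-- The lattice word condition fails in row `r` for the strips starting at levels `k`, `k + 1`. -/
def LatticeFails (m : ℕ) (q : ℕ → ℕ → ℤ) (r k : ℕ) : Prop :=
  r < m ∧ k + 2 ≤ m ∧ stripExcess q r k < q (k + 2) r - q (k + 1) r

/-- `p = (r, k)` is the first failure of the lattice word condition. -/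
def IsFirstFailure (m : ℕ) (q : ℕ → ℕ → ℤ) (p : ℕ × ℕ) : Prop :=
  LatticeFails m q p.1 p.2 ∧ (∀ r k, r < p.1 → ¬LatticeFails m q r k) ∧
    ∀ k, p.2 < k → ¬LatticeFails m q p.1 k

/-- Reflect the part of level `p.2 + 1` of `q` after the failure of the lattice word condition
at `p` in the interval of its admissible values (a partial Bender–Knuth involution). -/
def toggle (p : ℕ × ℕ) (q : ℕ → ℕ → ℤ) (i j : ℕ) : ℤ :=
  if i = p.2 + 1 ∧ p.1 ≤ j then
    max (q p.2 j) (q (p.2 + 2) (j + 1)) +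
      (if j = p.1 then q (p.2 + 2) j - stripExcess q p.1 p.2 - 1
        else min (q (p.2 + 2) j) (q p.2 (j - 1))) - q (p.2 + 1) j
  else q i j

section Toggle

variable {m : ℕ} {q : ℕ → ℕ → ℤ} {p : ℕ × ℕ}

theorem IsFirstFailure.unique {p' : ℕ × ℕ} (h : IsFirstFailure m q p)
    (h' : IsFirstFailure m q p') : p = p' := by
  obtain ⟨h₁, h₂, h₃⟩ := h
  obtain ⟨h₄, h₅, h₆⟩ := h'
  have hr : p.1 = p'.1 := by
    rcases lt_trichotomy p.1 p'.1 with h | h | h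
    · exact absurd h₁ (h₅ _ _ h)
    · exact h
    · exact absurd h₄ (h₂ _ _ h)
  refine Prod.ext hr ?_
  rcases lt_trichotomy p.2 p'.2 with h | h | h
  · exact absurd h₄ (hr ▸ h₃ _ h)
  · exact h
  · exact absurd h₁ (hr ▸ h₆ _ h)

theorem exists_isFirstFailure (h : ∃ r k, LatticeFails m q r k) : ∃ p, IsFirstFailure m q p := by
  classical
  have hk : ∃ k, LatticeFails m q (Nat.find h) k := Nat.find_spec h
  obtain ⟨k, hk⟩ := hk
  refine ⟨(Nat.find h, Nat.findGreatest (LatticeFails m q (Nat.find h)) m), ?_, ?_, ?_⟩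
  · exact Nat.findGreatest_spec (by have := hk.2.1; omega) hk
  · exact fun r k hr hf => Nat.find_min h hr ⟨k, hf⟩
  · intro k hk hf
    exact Nat.findGreatest_is_greatest hk (by have := hf.2.1; omega) hf

theorem toggle_of_ne_level {i : ℕ} (j : ℕ) (hi : i ≠ p.2 + 1) : toggle p q i j = q i j :=
  if_neg fun h => hi h.1

theorem toggle_of_row_lt (i : ℕ) {j : ℕ} (hj : j < p.1) : toggle p q i j = q i j :=
  if_neg fun h => absurd h.2 hj.not_ge

theorem toggle_failure_row :
    toggle p q (p.2 + 1) p.1 = max (q p.2 p.1) (q (p.2 + 2) (p.1 + 1)) +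
      (q (p.2 + 2) p.1 - stripExcess q p.1 p.2 - 1) - q (p.2 + 1) p.1 := by
  simp [toggle]

theorem toggle_succ_row {j : ℕ} (hj : p.1 ≤ j) :
    toggle p q (p.2 + 1) (j + 1) = max (q p.2 (j + 1)) (q (p.2 + 2) (j + 1 + 1)) +
      min (q (p.2 + 2) (j + 1)) (q p.2 j) - q (p.2 + 1) (j + 1) := by
  rw [toggle, if_pos ⟨rfl, by omega⟩, if_neg (by omega), Nat.add_sub_cancel]

theorem stripExcess_toggle {r : ℕ} (k : ℕ) (hr : r ≤ p.1) :
    stripExcess (toggle p q) r k = stripExcess q r k := by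
  refine Finset.sum_congr rfl fun s hs => ?_
  have : s < p.1 := (Finset.mem_range.mp hs).trans_le hr
  simp only [toggle_of_row_lt _ this]

theorem IsFirstFailure.sub_le_stripExcess (hq : IsFirstFailure m q p) {r : ℕ} (hr : p.1 = r + 1) :
    q (p.2 + 1) r - q p.2 r ≤ stripExcess q (r + 1) p.2 := by
  have h := hq.2.1 r p.2 (by omega)
  have h₁ := hq.1.1
  have h₂ := hq.1.2.1
  simp only [LatticeFails, not_and, not_lt] at h
  have := h (by omega) h₂
  rw [stripExcess, Finset.sum_range_succ, ← stripExcess]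
  linarith

theorem IsFirstFailure.toggle_bounds (hc : IsExtendedChain m q) (hq : IsFirstFailure m q p)
    (j : ℕ) :
    max (q p.2 j) (q (p.2 + 2) (j + 1)) ≤ toggle p q (p.2 + 1) j ∧
      toggle p q (p.2 + 1) j ≤ q (p.2 + 2) j ∧
        ∀ j', j = j' + 1 → toggle p q (p.2 + 1) j ≤ q p.2 j' := by
  obtain ⟨h₁, h₂, h₃⟩ := hq.1
  have hlo : max (q p.2 j) (q (p.2 + 2) (j + 1)) ≤ q (p.2 + 1) j :=
    max_le (hc.mono _ _ (by omega)) (hc.interlace _ _ (by omega))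
  have hhi : q (p.2 + 1) j ≤ q (p.2 + 2) j := hc.mono _ _ (by omega)
  have hhi' : ∀ j', j = j' + 1 → q (p.2 + 1) j ≤ q p.2 j' := by
    rintro j' rfl
    exact hc.interlace _ _ (by omega)
  rcases lt_trichotomy j p.1 with hj | rfl | hj
  · rw [toggle_of_row_lt _ hj]
    exact ⟨hlo, hhi, hhi'⟩
  · have hex : 0 ≤ stripExcess q p.1 p.2 := by
      rcases hr : p.1 with _ | r
      · simp [stripExcess]
      · have := hq.sub_le_stripExcess hr
        have := hc.mono p.2 r (by omega)
        linarith
    rw [toggle_failure_row]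
    refine ⟨by linarith, by linarith, fun j' hj' => ?_⟩
    have h₄ := hq.sub_le_stripExcess hj'
    have h₅ := hc.interlace (p.2 + 1) j' (by omega)
    rw [← hj'] at h₄ h₅
    linarith
  · obtain ⟨j, rfl⟩ : ∃ i, j = i + 1 := ⟨j - 1, by omega⟩
    rw [toggle_succ_row (by omega)]
    have hmin := le_min hhi (hhi' j rfl)
    refine ⟨by linarith, by linarith [min_le_left (q (p.2 + 2) (j + 1)) (q p.2 j)], ?_⟩
    intro j' hj'
    obtain rfl : j = j' := by omega
    linarith [min_le_right (q (p.2 + 2) (j + 1)) (q p.2 j)]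

theorem IsExtendedChain.toggle (hc : IsExtendedChain m q) (hq : IsFirstFailure m q p) :
    IsExtendedChain m (toggle p q) := by
  have hb := hq.toggle_bounds hc
  have hlevel : p.2 + 2 ≤ m := hq.1.2.1
  have hnonneg : ∀ j, 0 ≤ _root_.toggle p q (p.2 + 1) j := fun j =>
    (hc.nonneg p.2 j).trans ((le_max_left _ _).trans (hb j).1)
  refine ⟨fun i j => ?_, fun i j hi => ?_, fun i j hj => ?_, fun i j hi => ?_, fun i j hi => ?_⟩
  · by_cases h : i = p.2 + 1
    · exact h ▸ hnonneg j
    · rw [toggle_of_ne_level _ h]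
      exact hc.nonneg i j
  · rw [toggle_of_ne_level _ (by omega)]
    exact hc.level_zero i j hi
  · by_cases h : i = p.2 + 1
    · subst h
      have := (hb j).2.1
      rw [hc.row_zero _ _ hj] at this
      exact le_antisymm this (hnonneg j)
    · rw [toggle_of_ne_level _ h]
      exact hc.row_zero i j hj
  · by_cases h : i = p.2 + 1
    · subst h
      rw [toggle_of_ne_level (i := p.2 + 1 + 1) _ (by omega)]
      exact (hb j).2.1
    · rw [toggle_of_ne_level _ h]
      by_cases h' : i = p.2
      · subst h'
        exact (le_max_left _ _).trans (hb j).1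
      · rw [toggle_of_ne_level _ (by omega)]
        exact hc.mono i j hi
  · by_cases h : i = p.2 + 1
    · subst h
      rw [toggle_of_ne_level (i := p.2 + 1 + 1) _ (by omega)]
      exact (le_max_right _ _).trans (hb j).1
    · rw [toggle_of_ne_level (i := i) _ h]
      by_cases h' : i = p.2
      · subst h'
        exact (hb (j + 1)).2.2 j rfl
      · rw [toggle_of_ne_level _ (by omega)]
        exact hc.interlace i j hi

theorem IsFirstFailure.toggle (hc : IsExtendedChain m q) (hq : IsFirstFailure m q p) :
    IsFirstFailure m (toggle p q) p := by
  obtain ⟨⟨h₁, h₂, h₃⟩, h₄, h₅⟩ := hq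
  refine ⟨⟨h₁, h₂, ?_⟩, fun r k hr hf => ?_, fun k hk hf => ?_⟩
  · rw [stripExcess_toggle _ le_rfl, toggle_failure_row, toggle_of_ne_level _ (by omega)]
    have : max (q p.2 p.1) (q (p.2 + 2) (p.1 + 1)) ≤ q (p.2 + 1) p.1 :=
      max_le (hc.mono _ _ (by omega)) (hc.interlace _ _ (by omega))
    linarith
  · refine h₄ r k hr ⟨hf.1, hf.2.1, ?_⟩
    have := hf.2.2
    rwa [stripExcess_toggle _ hr.le, toggle_of_row_lt _ hr, toggle_of_row_lt _ hr] at this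
  · refine h₅ k hk ⟨hf.1, hf.2.1, ?_⟩
    have := hf.2.2
    rwa [stripExcess_toggle _ le_rfl, toggle_of_ne_level _ (by omega),
      toggle_of_ne_level _ (by omega)] at this

theorem toggle_toggle : toggle p (toggle p q) = q := by
  ext i j
  by_cases h : i = p.2 + 1
  · subst h
    rcases lt_trichotomy j p.1 with hj | rfl | hj
    · rw [toggle_of_row_lt _ hj, toggle_of_row_lt _ hj]
    · rw [toggle_failure_row, stripExcess_toggle _ le_rfl, toggle_failure_row,
        toggle_of_ne_level _ (by omega), toggle_of_ne_level _ (by omega),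
        toggle_of_ne_level _ (by omega)]
      ring
    · obtain ⟨j, rfl⟩ : ∃ i, j = i + 1 := ⟨j - 1, by omega⟩
      rw [toggle_succ_row (by omega), toggle_succ_row (by omega),
        toggle_of_ne_level _ (by omega), toggle_of_ne_level _ (by omega),
        toggle_of_ne_level _ (by omega), toggle_of_ne_level _ (by omega)]
      ring
  · rw [toggle_of_ne_level _ h, toggle_of_ne_level _ h]

theorem sum_range_succ_toggle {t : ℕ} (ht : p.1 ≤ t) :
    ∑ s ∈ Finset.range (t + 1), toggle p q (p.2 + 1) s =
      ∑ s ∈ Finset.range (t + 1), (q p.2 s + q (p.2 + 2) s - q (p.2 + 1) s) - 1 +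
        (max (q p.2 t) (q (p.2 + 2) (t + 1)) - q p.2 t) := by
  induction t, ht using Nat.le_induction with
  | base =>
    have h : ∑ s ∈ Finset.range p.1, toggle p q (p.2 + 1) s =
        ∑ s ∈ Finset.range p.1, (q p.2 s + q (p.2 + 2) s - q (p.2 + 1) s) +
          stripExcess q p.1 p.2 := by
      rw [stripExcess, ← Finset.sum_add_distrib]
      refine Finset.sum_congr rfl fun s hs => ?_
      rw [toggle_of_row_lt _ (Finset.mem_range.mp hs)]
      ring
    rw [Finset.sum_range_succ, h, toggle_failure_row, Finset.sum_range_succ]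
    ring
  | succ t ht ih =>
    rw [Finset.sum_range_succ, ih, toggle_succ_row ht, Finset.sum_range_succ _ (t + 1)]
    linarith [max_add_min (q p.2 t) (q (p.2 + 2) (t + 1)),
      min_comm (q p.2 t) (q (p.2 + 2) (t + 1))]

theorem IsFirstFailure.sum_toggle (hc : IsExtendedChain m q) (hq : IsFirstFailure m q p) :
    ∑ s ∈ Finset.range m, _root_.toggle p q (p.2 + 1) s =
      ∑ s ∈ Finset.range m, q p.2 s + ∑ s ∈ Finset.range m, q (p.2 + 2) s -
        ∑ s ∈ Finset.range m, q (p.2 + 1) s - 1 := by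
  have hr : p.1 < m := hq.1.1
  obtain ⟨t, rfl⟩ : ∃ t, m = t + 1 := ⟨m - 1, by omega⟩
  rw [sum_range_succ_toggle (by omega), hc.row_zero (p.2 + 2) (t + 1) le_rfl,
    max_eq_left (hc.nonneg _ _), Finset.sum_sub_distrib, Finset.sum_add_distrib]
  ring

theorem IsExtendedChain.content_antitone (hc : IsExtendedChain m q)
    (h : ∀ r k, ¬LatticeFails m q r k) {k : ℕ} (hk : k + 2 ≤ m) :
    ∑ s ∈ Finset.range m, q (k + 2) s - ∑ s ∈ Finset.range m, q (k + 1) s ≤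
      ∑ s ∈ Finset.range m, q (k + 1) s - ∑ s ∈ Finset.range m, q k s := by
  obtain ⟨t, rfl⟩ : ∃ t, m = t + 1 := ⟨m - 1, by omega⟩
  have h₁ := h t k
  simp only [LatticeFails, not_and, not_lt] at h₁
  have h₂ := h₁ (by omega) hk
  have h₃ := hc.mono k t (by omega)
  rw [stripExcess, Finset.sum_sub_distrib, Finset.sum_sub_distrib, ← Finset.mul_sum] at h₂
  simp only [Finset.sum_range_succ]
  linarith

end Toggle

/-- A chain of shapes indexed by natural numbers, extended by zero. -/
def extendChain {m : ℕ} (Q : Fin (m + 1) → Fin m → ℕ) (i j : ℕ) : ℤ :=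
  if h : i < m + 1 ∧ j < m then Q ⟨i, h.1⟩ ⟨j, h.2⟩ else 0

theorem extendChain_val {m : ℕ} (Q : Fin (m + 1) → Fin m → ℕ) (i : Fin (m + 1)) (j : Fin m) :
    extendChain Q i j = Q i j :=
  dif_pos ⟨i.isLt, j.isLt⟩

theorem sum_range_extendChain {m : ℕ} (Q : Fin (m + 1) → Fin m → ℕ) (i : Fin (m + 1)) :
    ∑ s ∈ Finset.range m, extendChain Q i s = ∑ j, (Q i j : ℤ) := by
  rw [Finset.sum_range]
  exact Finset.sum_congr rfl fun j _ => extendChain_val Q i j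

theorem chainContent_eq_extendChain {m : ℕ} (Q : Fin (m + 1) → Fin m → ℕ) (i : Fin m) :
    chainContent Q i = ∑ s ∈ Finset.range m, extendChain Q (i + 1) s -
      ∑ s ∈ Finset.range m, extendChain Q i s := by
  rw [chainContent, ← sum_range_extendChain, ← sum_range_extendChain]
  rfl

theorem isExtendedChain_extendChain_iff {m : ℕ} (Q : Fin (m + 1) → Fin m → ℕ) :
    IsExtendedChain m (extendChain Q) ↔ IsStripChain Q := by
  constructor
  · intro h i
    refine ⟨fun j => ?_, fun j j' hj => ?_⟩
    · have := h.mono i j i.isLt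
      have h₁ := extendChain_val Q i.castSucc j
      have h₂ := extendChain_val Q i.succ j
      rw [Fin.val_castSucc] at h₁
      rw [Fin.val_succ] at h₂
      omega
    · have := h.interlace i j i.isLt
      have h₁ := extendChain_val Q i.castSucc j
      have h₂ := extendChain_val Q i.succ j'
      rw [Fin.val_castSucc] at h₁
      rw [Fin.val_succ, ← hj] at h₂
      omega
  · intro h
    have hnonneg : ∀ i j, 0 ≤ extendChain Q i j := by
      intro i j
      unfold extendChain
      split_ifs <;> positivity
    refine ⟨hnonneg, fun i j hi => dif_neg (by omega), fun i j hj => dif_neg (by omega), ?_, ?_⟩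
    · intro i j hi
      by_cases hj : j < m
      · rw [extendChain, extendChain, dif_pos ⟨by omega, hj⟩, dif_pos ⟨by omega, hj⟩]
        exact_mod_cast (h ⟨i, hi⟩).1 ⟨j, hj⟩
      · rw [extendChain, extendChain, dif_neg (by omega), dif_neg (by omega)]
    · intro i j hi
      by_cases hj : j + 1 < m
      · rw [extendChain, extendChain, dif_pos ⟨by omega, hj⟩, dif_pos ⟨by omega, by omega⟩]
        exact_mod_cast (h ⟨i, hi⟩).2 ⟨j, by omega⟩ ⟨j + 1, hj⟩ rfl
      · rw [extendChain, dif_neg (by omega)]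
        exact hnonneg i j

/-- The restriction of an extended chain to a chain in a box. -/
def restrictChain {m : ℕ} (N : ℕ) (q : ℕ → ℕ → ℤ) : Fin (m + 1) → Fin m → Fin (N + 1) :=
  fun i j => Fin.ofNat (N + 1) (q i j).toNat

theorem restrictChain_extendChain {m N : ℕ} (Q : Fin (m + 1) → Fin m → Fin (N + 1)) :
    restrictChain N (extendChain (boxChain Q)) = Q := by
  ext i j
  simp only [restrictChain, extendChain_val, Int.toNat_natCast, boxChain, Fin.val_ofNat]
  exact Nat.mod_eq_of_lt (Q i j).isLt

theorem extendChain_restrictChain {m N : ℕ} {q : ℕ → ℕ → ℤ} (hq : IsExtendedChain m q)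
    (hN : ∀ i j, q i j ≤ N) : extendChain (boxChain (restrictChain (m := m) N q)) = q := by
  ext i j
  unfold extendChain
  split_ifs with h
  · simp only [boxChain, restrictChain, Fin.val_ofNat]
    have h₁ := hq.nonneg i j
    have h₂ := hN i j
    rw [Nat.mod_eq_of_lt (by omega)]
    omega
  · by_cases hi : m < i
    · exact (hq.level_zero i j hi).symm
    · exact (hq.row_zero i j (by omega)).symm

/-- The partial Bender–Knuth involution on chains in a box. -/
def toggleChain {m N : ℕ} (p : ℕ × ℕ) (Q : Fin (m + 1) → Fin m → Fin (N + 1)) :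
    Fin (m + 1) → Fin m → Fin (N + 1) :=
  restrictChain N (toggle p (extendChain (boxChain Q)))

section ToggleChain

variable {m N : ℕ} {Q : Fin (m + 1) → Fin m → Fin (N + 1)} {p : ℕ × ℕ}

theorem extendChain_toggleChain (hQ : IsStripChain (boxChain Q))
    (hp : IsFirstFailure m (extendChain (boxChain Q)) p) :
    extendChain (boxChain (toggleChain p Q)) = toggle p (extendChain (boxChain Q)) := by
  have hc := (isExtendedChain_extendChain_iff _).mpr hQ
  have hle : ∀ i j, extendChain (boxChain Q) i j ≤ N := by
    intro i j
    unfold extendChain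
    split_ifs
    · have := (Q ⟨i, by omega⟩ ⟨j, by omega⟩).isLt
      simp only [boxChain]
      omega
    · positivity
  refine extendChain_restrictChain (hc.toggle hp) fun i j => ?_
  by_cases h : i = p.2 + 1
  · subst h
    exact ((hp.toggle_bounds hc j).2.1).trans (hle _ _)
  · rw [toggle_of_ne_level _ h]
    exact hle i j

theorem IsFirstFailure.toggleChain_toggleChain (hQ : IsStripChain (boxChain Q))
    (hp : IsFirstFailure m (extendChain (boxChain Q)) p) :
    toggleChain p (toggleChain p Q) = Q := by
  rw [toggleChain, extendChain_toggleChain hQ hp, toggle_toggle, restrictChain_extendChain]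

theorem IsFirstFailure.isStripChain_toggleChain (hQ : IsStripChain (boxChain Q))
    (hp : IsFirstFailure m (extendChain (boxChain Q)) p) :
    IsStripChain (boxChain (toggleChain p Q)) := by
  rw [← isExtendedChain_extendChain_iff, extendChain_toggleChain hQ hp]
  exact ((isExtendedChain_extendChain_iff _).mpr hQ).toggle hp

theorem IsFirstFailure.toggleChain_apply (hQ : IsStripChain (boxChain Q))
    (hp : IsFirstFailure m (extendChain (boxChain Q)) p) {i : Fin (m + 1)}
    (hi : (i : ℕ) ≠ p.2 + 1) : toggleChain p Q i = Q i := by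
  ext j
  have h := congrFun (congrFun (extendChain_toggleChain hQ hp) i) j
  rw [toggle_of_ne_level _ hi, extendChain_val, extendChain_val] at h
  exact_mod_cast h

theorem IsFirstFailure.chainContent_toggleChain (hQ : IsStripChain (boxChain Q))
    (hp : IsFirstFailure m (extendChain (boxChain Q)) p) {a b : Fin m} (ha : (a : ℕ) = p.2)
    (hb : (b : ℕ) = p.2 + 1) (i : Fin m) :
    chainContent (boxChain (toggleChain p Q)) i - i =
      chainContent (boxChain Q) (Equiv.swap a b i) - (Equiv.swap a b i : Fin m) := by
  have hc := (isExtendedChain_extendChain_iff _).mpr hQ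
  have hsum := hp.sum_toggle hc
  have hother : ∀ l, l ≠ p.2 + 1 →
      ∑ s ∈ Finset.range m, _root_.toggle p (extendChain (boxChain Q)) l s =
        ∑ s ∈ Finset.range m, extendChain (boxChain Q) l s := fun l hl =>
    Finset.sum_congr rfl fun s _ => toggle_of_ne_level s hl
  rw [chainContent_eq_extendChain, chainContent_eq_extendChain, extendChain_toggleChain hQ hp]
  rcases eq_or_ne i a with rfl | hia
  · rw [Equiv.swap_apply_left, ha, hb, hsum, hother p.2 (by omega)]
    push_cast
    ring
  rcases eq_or_ne i b with rfl | hib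
  · rw [Equiv.swap_apply_right, ha, hb, hsum, hother (p.2 + 1 + 1) (by omega)]
    push_cast
    ring
  · rw [Equiv.swap_apply_of_ne_of_ne hia hib]
    rw [Fin.ne_iff_vne] at hia hib
    rw [hother (i + 1) (by omega), hother i (by omega)]

end ToggleChain

/-- The sign of the permutation sorting `α - id` to `μ - id`, or `0` if there is none. -/
def contentSign {m : ℕ} (μ : Fin m → ℕ) (α : Fin m → ℤ) : ℤ :=
  Matrix.det (Matrix.of fun j i : Fin m => if α i - i = (μ j : ℤ) - j then 1 else 0)

theorem contentSign_eq_neg_of_swap {m : ℕ} (μ : Fin m → ℕ) {α β : Fin m → ℤ} {a b : Fin m}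
    (hab : a ≠ b)
    (h : ∀ i, β i - i = α (Equiv.swap a b i) - (Equiv.swap a b i : Fin m)) :
    contentSign μ β = -contentSign μ α := by
  have := Matrix.det_permute' (Equiv.swap a b)
    (Matrix.of fun j i : Fin m => if α i - i = (μ j : ℤ) - j then (1 : ℤ) else 0)
  rw [Equiv.Perm.sign_swap hab] at this
  simpa [contentSign, Matrix.submatrix, h] using this

theorem contentSign_eq_sum {m : ℕ} (μ : Fin m → ℕ) (α : Fin m → ℤ) :
    contentSign μ α = ∑ σ : Equiv.Perm (Fin m), (Equiv.Perm.sign σ : ℤ) *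
      if α = fun i => (μ (σ i) : ℤ) + i - (σ i : Fin m) then 1 else 0 := by
  rw [contentSign, Matrix.det_apply']
  refine Finset.sum_congr rfl fun σ _ => ?_
  simp only [Matrix.of_apply]
  rw [Finset.prod_ite_zero]
  simp only [Finset.prod_const_one, Int.cast_id]
  congr 2
  rw [_root_.funext_iff, eq_iff_iff]
  refine ⟨fun h i => ?_, fun h i _ => ?_⟩
  · have := h i (Finset.mem_univ i)
    omega
  · have := h i
    omega

theorem contentSign_of_antitone {m : ℕ} {μ : Fin m → ℕ} {α : Fin m → ℤ} (hμ : Antitone μ)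
    (hα : Antitone α) : contentSign μ α = if α = fun i => (μ i : ℤ) then 1 else 0 := by
  rw [contentSign_eq_sum, Finset.sum_eq_single 1]
  · simp
  · intro σ _ hσ
    rw [if_neg, mul_zero]
    intro h
    refine hσ (Equiv.ext fun i => ?_)
    have hmono : StrictMono σ := by
      intro i j hij
      by_contra! hcon
      have h₁ : (μ (σ i) : ℤ) ≤ μ (σ j) := by exact_mod_cast hμ hcon
      have h₂ := congrFun h i
      have h₃ := congrFun h j
      have h₄ := hα hij.le
      rw [Fin.lt_def] at hij
      rw [Fin.le_def] at hcon
      omega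
    have := Subsingleton.elim (hmono.orderIsoOfSurjective σ σ.surjective) (OrderIso.refl (Fin m))
    exact congrArg (fun e : Fin m ≃o Fin m => e i) this
  · simp

open Classical in
theorem schurPoly_mul_schurPoly_eq_sum_contentSign {m N : ℕ} (μ : Fin m → ℕ)
    (ν : Fin m → Fin (N + 1)) (hν : Antitone fun j => (ν j : ℕ))
    (hN : ∑ j, (ν j : ℕ) + ∑ j, (μ j + m) ≤ N) :
    schurPoly m (fun j => ν j) * schurPoly m μ =
      ∑ Q : Fin (m + 1) → Fin m → Fin (N + 1) with Q 0 = ν ∧ IsStripChain (boxChain Q),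
        contentSign μ (chainContent (boxChain Q)) •
          schurPoly m (boxChain Q (Fin.last m)) := by
  simp only [contentSign_eq_sum, Finset.sum_smul]
  rw [Finset.sum_comm, schurPoly_eq_det_completeHomogInt m μ, Matrix.det_apply, Finset.mul_sum]
  refine Finset.sum_congr rfl fun σ _ => ?_
  rw [mul_smul_comm]
  simp only [Matrix.of_apply, mul_smul, ite_smul, one_smul, zero_smul]
  rw [schurPoly_mul_prod_completeHomogInt ν hν, ← Finset.smul_sum, ← Finset.sum_filter,
    Finset.filter_filter, Units.smul_def]
  · simp only [and_assoc]
  · refine (Nat.add_le_add_left ?_ _).trans hN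
    rw [← Equiv.sum_comp σ fun j => μ j + m]
    refine Finset.sum_le_sum fun i _ => ?_
    have := i.isLt
    omega

open Classical in
theorem sum_contentSign_latticeFails {m N : ℕ} (μ : Fin m → ℕ) (ν : Fin m → Fin (N + 1)) :
    ∑ Q : Fin (m + 1) → Fin m → Fin (N + 1) with (Q 0 = ν ∧ IsStripChain (boxChain Q)) ∧
        ∃ r k, LatticeFails m (extendChain (boxChain Q)) r k,
      contentSign μ (chainContent (boxChain Q)) • schurPoly m (boxChain Q (Fin.last m)) = 0 := by
  refine Finset.sum_eq_zero_of_sign_reversing _ _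
    (fun Q p => IsFirstFailure m (extendChain (boxChain Q)) p) toggleChain ?_ ?_ ?_ ?_ ?_ ?_
  · exact fun Q hQ => exists_isFirstFailure (Finset.mem_filter.mp hQ).2.2
  · exact fun Q p p' hp hp' => hp.unique hp'
  all_goals
    intro Q hQ p hp
    obtain ⟨-, ⟨rfl, hc⟩, -⟩ := Finset.mem_filter.mp hQ
    have hce := (isExtendedChain_extendChain_iff _).mpr hc
  · refine Finset.mem_filter.mpr ⟨Finset.mem_univ _, ⟨?_, hp.isStripChain_toggleChain hc⟩, ?_⟩
    · exact hp.toggleChain_apply hc (by simp)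
    · rw [extendChain_toggleChain hc hp]
      exact ⟨_, _, (hp.toggle hce).1⟩
  · rw [extendChain_toggleChain hc hp]
    exact hp.toggle hce
  · exact hp.toggleChain_toggleChain hc
  · have hlevel : p.2 + 2 ≤ m := hp.1.2.1
    rw [contentSign_eq_neg_of_swap μ (a := ⟨p.2, by omega⟩) (b := ⟨p.2 + 1, by omega⟩)
      (by simp) (hp.chainContent_toggleChain hc rfl rfl), neg_smul]
    unfold boxChain
    rw [hp.toggleChain_apply hc (by rw [Fin.val_last]; omega)]

theorem chainContent_antitone {m : ℕ} {Q : Fin (m + 1) → Fin m → ℕ} (hQ : IsStripChain Q)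
    (h : ∀ r k, ¬LatticeFails m (extendChain Q) r k) : Antitone (chainContent Q) := by
  have hc := (isExtendedChain_extendChain_iff _).mpr hQ
  cases m with
  | zero => exact Subsingleton.antitone _
  | succ n =>
    refine Fin.antitone_iff_succ_le.mpr fun i => ?_
    rw [chainContent_eq_extendChain, chainContent_eq_extendChain]
    exact hc.content_antitone h (by omega)

open Classical in
/-- The Littlewood–Richardson rule. -/
theorem schurPoly_mul_schurPoly_eq_sum {m N : ℕ} {μ : Fin m → ℕ} (hμ : Antitone μ)
    (ν : Fin m → Fin (N + 1)) (hν : Antitone fun j => (ν j : ℕ))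
    (hN : ∑ j, (ν j : ℕ) + ∑ j, (μ j + m) ≤ N) :
    schurPoly m (fun j => ν j) * schurPoly m μ =
      ∑ Q : Fin (m + 1) → Fin m → Fin (N + 1) with
        ((Q 0 = ν ∧ IsStripChain (boxChain Q)) ∧
          ¬∃ r k, LatticeFails m (extendChain (boxChain Q)) r k) ∧
            chainContent (boxChain Q) = fun i => (μ i : ℤ),
        schurPoly m (boxChain Q (Fin.last m)) := by
  rw [schurPoly_mul_schurPoly_eq_sum_contentSign μ ν hν hN,
    ← Finset.sum_filter_add_sum_filter_not _ fun Q : Fin (m + 1) → Fin m → Fin (N + 1) =>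
      ∃ r k, LatticeFails m (extendChain (boxChain Q)) r k,
    Finset.filter_filter, Finset.filter_filter, sum_contentSign_latticeFails, zero_add]
  conv_rhs => rw [← Finset.filter_filter, Finset.sum_filter]
  refine Finset.sum_congr rfl fun Q hQ => ?_
  obtain ⟨-, ⟨-, hc⟩, h⟩ := Finset.mem_filter.mp hQ
  push Not at h
  rw [contentSign_of_antitone hμ (chainContent_antitone hc h), ite_smul, one_smul, zero_smul]

/-- The product of two Schur polynomials is a nonnegative integer linear combination
of Schur polynomials (Littlewood–Richardson positivity). -/
theorem schurPoly_mul_schurPoly_nonneg_combination (m : ℕ) (μ ν : Fin m → ℕ)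
    (hμ : Antitone μ) (hν : Antitone ν) :
    ∃ c : (Fin m → ℕ) →₀ ℕ, (∀ lam ∈ c.support, Antitone lam) ∧
      schurPoly m μ * schurPoly m ν = c.sum fun lam k => k • schurPoly m lam := by
  classical
  obtain ⟨N, hN⟩ : ∃ N, N = ∑ j, ν j + ∑ j, (μ j + m) := ⟨_, rfl⟩
  obtain ⟨ν', rfl⟩ : ∃ ν' : Fin m → Fin (N + 1), (fun j => (ν' j : ℕ)) = ν := by
    refine ⟨fun j => ⟨ν j, ?_⟩, rfl⟩
    have := Finset.single_le_sum (f := ν) (fun i _ => Nat.zero_le _) (Finset.mem_univ j)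
    omega
  have h := schurPoly_mul_schurPoly_eq_sum hμ ν' hν hN.ge
  set S := Finset.univ.filter fun Q : Fin (m + 1) → Fin m → Fin (N + 1) =>
    ((Q 0 = ν' ∧ IsStripChain (boxChain Q)) ∧
      ¬∃ r k, LatticeFails m (extendChain (boxChain Q)) r k) ∧
        chainContent (boxChain Q) = fun i => (μ i : ℤ) with hS
  refine ⟨∑ Q ∈ S, Finsupp.single (boxChain Q (Fin.last m)) 1, fun lam hlam => ?_, ?_⟩
  · obtain ⟨Q, hQ, hmem⟩ := Finset.mem_biUnion.mp (Finsupp.support_finsetSum hlam)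
    rw [Finset.mem_singleton.mp (Finsupp.support_single_subset hmem)]
    have hc := (Finset.mem_filter.mp hQ).2.1.1.2
    cases m with
    | zero => exact Subsingleton.antitone _
    | succ n => exact (hc (Fin.last n)).antitone
  · rw [mul_comm, h, ← Finsupp.sum_finsetSum_index (by simp) (by simp [add_smul])]
    simp
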